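/- Let n ≥ 1 be a natural number and let T : ℕ → ℕ → ℤ satisfy T_r(0) = 1 for all r and T_r(k) = 4·(n - r - k)·T_r(k-1) - 2·(n - 2r - δ(n-1))·T_{r+1}(k-1) whenever k ≥ 1 and r + k ≤ ⌊n/2⌋. Then T_0(⌊n/2⌋) = 2^{δ(n-1)} · ∏_{j=1}^{⌊n/2⌋}(n - j). -/

import Mathlib

/-- The falling product `(2m)(2m-1)⋯(m+1)` equals `∏_{i<m} (4m - 2 - 4i)`. -/
lemma prod_range_four_mul_sub_eq (m : ℕ) :
    ∏ i ∈ Finset.range m, (4 * (m : ℤ) - 2 - 4 * i) =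
      ∏ i ∈ Finset.range m, (2 * (m : ℤ) - i) := by
  induction m with
  | zero => simp
  | succ m ih =>
    have hL : ∏ i ∈ Finset.range (m + 1), (4 * ((m + 1 : ℕ) : ℤ) - 2 - 4 * i) =
        (∏ i ∈ Finset.range m, (4 * (m : ℤ) - 2 - 4 * i)) * (4 * m + 2) := by
      rw [Finset.prod_range_succ']
      congr 1
      · exact Finset.prod_congr rfl fun i _ => by push_cast; ring
      · push_cast; ring
    have hR : (∏ i ∈ Finset.range (m + 1), (2 * ((m + 1 : ℕ) : ℤ) - i)) * (m + 1) =
        (∏ i ∈ Finset.range m, (2 * (m : ℤ) - i)) * (2 * m + 1) * (2 * m + 2) := by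
      have h := Finset.prod_range_succ (fun i : ℕ => 2 * ((m + 1 : ℕ) : ℤ) - i) (m + 1)
      rw [Finset.prod_range_succ', Finset.prod_range_succ'] at h
      convert h.symm using 1
      · push_cast; ring
      · congr 1
        · congr 1
          · exact Finset.prod_congr rfl fun i _ => by push_cast; ring
          · push_cast; ring
    have hm : (m : ℤ) + 1 ≠ 0 := by positivity
    apply mul_right_cancel₀ hm
    rw [hR, hL, ih]
    ring

/-- Halving form: `(2m)(2m-1)⋯(m+1) = 2 (2m-1)(2m-2)⋯m` for `m ≥ 1`. -/
lemma prod_range_two_mul_sub_eq {m : ℕ} (hm : 1 ≤ m) :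
    ∏ i ∈ Finset.range m, (2 * (m : ℤ) - i) =
      2 * ∏ i ∈ Finset.range m, (2 * (m : ℤ) - 1 - i) := by
  have h := Finset.prod_range_succ (fun i : ℕ => 2 * (m : ℤ) - i) m
  rw [Finset.prod_range_succ'] at h
  have hc : ∏ i ∈ Finset.range m, (2 * (m : ℤ) - ((i + 1 : ℕ) : ℤ)) =
      ∏ i ∈ Finset.range m, (2 * (m : ℤ) - 1 - i) :=
    Finset.prod_congr rfl fun i _ => by push_cast; ring
  rw [hc] at h
  have hm' : (m : ℤ) ≠ 0 := by positivity
  apply mul_right_cancel₀ hm'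
  push_cast at h
  linear_combination -h

/-- The recurrence has a solution independent of `r`. -/
lemma recurrence_eq_prod (n d M : ℤ) (m : ℕ) (T : ℕ → ℕ → ℤ) (hM : 2 * n + 2 * d = M)
    (hT0 : ∀ r, T r 0 = 1)
    (hT : ∀ r k, 1 ≤ k → r + k ≤ m →
      T r k = 4 * (n - r - k) * T r (k - 1) - 2 * (n - 2 * r - d) * T (r + 1) (k - 1))
    (k r : ℕ) (h : r + k ≤ m) :
    T r k = ∏ i ∈ Finset.range k, (M - 4 - 4 * i) := by
  induction k generalizing r with
  | zero => simp [hT0]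
  | succ k ih =>
    rw [hT r (k + 1) (by omega) h, Nat.add_sub_cancel, ih r (by omega),
      ih (r + 1) (by omega), Finset.prod_range_succ, ← hM]
    push_cast
    ring

theorem omega_power_of_two
    (n : ℕ) (hn : 1 ≤ n)
    (T : ℕ → ℕ → ℤ)
    (hT0 : ∀ r, T r 0 = 1)
    (hT : ∀ r k, 1 ≤ k → r + k ≤ n / 2 →
      T r k = 4 * ((n : ℤ) - r - k) * T r (k - 1)
        - 2 * ((n : ℤ) - 2 * r - ((n - 1) % 2 : ℕ)) * T (r + 1) (k - 1)) :
    T 0 (n / 2) = 2 ^ ((n - 1) % 2) * ∏ j ∈ Finset.Icc 1 (n / 2), ((n : ℤ) - j) := by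
  have hIcc : ∏ j ∈ Finset.Icc 1 (n / 2), ((n : ℤ) - j) =
      ∏ i ∈ Finset.range (n / 2), ((n : ℤ) - 1 - i) := by
    rw [Finset.range_eq_Ico, ← Finset.Ico_add_one_right_eq_Icc,
      ← Finset.prod_Ico_add' _ 0 (n / 2) 1]
    exact Finset.prod_congr rfl fun i _ => by push_cast; ring
  have hsum : 2 * (n : ℤ) + 2 * ((n - 1) % 2 : ℕ) = 4 * ((n / 2 : ℕ) : ℤ) + 2 := by omega
  have hprod := recurrence_eq_prod n _ _ (n / 2) T hsum hT0 hT (n / 2) 0 (by omega)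
  have hshift : ∏ i ∈ Finset.range (n / 2), (4 * ((n / 2 : ℕ) : ℤ) + 2 - 4 - 4 * i) =
      ∏ i ∈ Finset.range (n / 2), (4 * ((n / 2 : ℕ) : ℤ) - 2 - 4 * i) :=
    Finset.prod_congr rfl fun i _ => by ring
  rw [hprod, hshift, hIcc, prod_range_four_mul_sub_eq]
  rcases Nat.mod_two_eq_zero_or_one (n - 1) with h | h
  · have hodd : (n : ℤ) - 1 = 2 * ((n / 2 : ℕ) : ℤ) := by omega
    rw [h, hodd, pow_zero, one_mul]
  · have heven : (n : ℤ) - 1 = 2 * ((n / 2 : ℕ) : ℤ) - 1 := by omega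
    rw [h, heven, pow_one, prod_range_two_mul_sub_eq (by omega)]
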